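/- arXiv:2501.14793 — 6 statements merged into one kernel-verified Lean document; each statement's English description precedes it below -/
import Mathlib

section
/- Let (A,⊞,e) be a unital magma that is ρ-reversible with respect to an endofunction ρ : A → A. Then ρ is a strong morphism onto the dual multioperation: for all x,y ∈ A, the image ρ '' (x⊞y) equals ρ(y)⊞ρ(x). -/
/-- `e` is a neutral element for the multioperation `m`. -/
def IsNeutral {A : Type*} (m : A → A → Set A) (e : A) : Prop :=
  ∀ x : A, m e x = {x} ∧ m x e = {x}

/-- The magma `(A, m)` is reversible with respect to the endofunction `ρ`. -/
def IsReversible {A : Type*} (m : A → A → Set A) (ρ : A → A) : Prop :=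
  ∀ x y z : A, z ∈ m x y → x ∈ m z (ρ y) ∧ y ∈ m (ρ x) z

/-- In a `ρ`-reversible unital magma, `ρ` is a strong morphism onto the dual
multioperation: `ρ '' (x ⊞ y) = ρ(y) ⊞ ρ(x)`. -/
theorem rho_strong_morphism_dual {A : Type*} (m : A → A → Set A) (e : A) (ρ : A → A)
    (hneut : IsNeutral m e) (hrev : IsReversible m ρ) :
    ∀ x y : A, ρ '' (m x y) = m (ρ y) (ρ x) := by
  have fwd : ∀ x y z : A, z ∈ m x y → ρ z ∈ m (ρ y) (ρ x) := fun x y z h =>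
    (hrev _ _ _ (hrev _ _ _ (hrev _ _ _ h).2).1).2
  have inv : ∀ x : A, ρ (ρ x) = x := fun x => by
    have h0 : x ∈ m x e := by rw [(hneut x).2]; rfl
    have h1 := (hrev _ _ _ (hrev _ _ _ h0).2).2
    rw [(hneut _).2] at h1
    exact h1.symm
  intro x y
  ext w
  constructor
  · rintro ⟨z, hz, rfl⟩
    exact fwd _ _ _ hz
  · intro hw
    have h := fwd _ _ _ hw
    rw [inv, inv] at h
    exact ⟨ρ w, h, inv w⟩
end

section
/- Let (A,⊞,0) be an L-mosaic. Then the relation defined by y ≤ x if and only if y ∈ x⊞x is a partial order on A (reflexive, antisymmetric and transitive), and 0 is a bottom element for this order (0 ≤ x for all x ∈ A). -/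
/-- Extension of a multioperation to subsets: `S ⊞ T := ⋃ {s ⊞ t : s ∈ S, t ∈ T}`. -/
def setMul {A : Type*} (m : A → A → Set A) (S T : Set A) : Set A :=
  ⋃ s ∈ S, ⋃ t ∈ T, m s t

/-- In an L-mosaic `(A, ⊞, 0)`, the relation `y ≤ x ↔ y ∈ x ⊞ x` is a partial
order with bottom element `0`. -/
theorem lmosaic_order {A : Type*} (m : A → A → Set A) (z₀ : A)
    (hcomm : ∀ x y : A, m x y = m y x)
    (hneut : ∀ x : A, m z₀ x = {x})
    (hrev : ∀ x y z : A, z ∈ m x y → x ∈ m z y ∧ y ∈ m x z)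
    (hlm1 : ∀ x : A, z₀ ∈ m x x ∧ x ∈ m x x)
    (hlm2 : ∀ x : A, setMul m (m x x) (m x x) = m x x)
    (hlm3 : ∀ x y : A, setMul m {x} (m x y) ∩ setMul m (m x y) {y} ⊆ m x y)
    (hlm4 : ∀ x y : A, ∃! z : A, z ∈ m x y ∧ x ∈ m z z ∧ y ∈ m z z) :
    (∀ x : A, x ∈ m x x) ∧
    (∀ x y : A, y ∈ m x x → x ∈ m y y → x = y) ∧
    (∀ x y z : A, x ∈ m y y → y ∈ m z z → x ∈ m z z) ∧
    (∀ x : A, z₀ ∈ m x x) := by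
  refine ⟨fun x => (hlm1 x).2, ?_, ?_, fun x => (hlm1 x).1⟩
  · intro x y hyx hxy
    have h1 : x ∈ m x y := by
      rw [hcomm]
      exact (hrev x x y hyx).1
    have h2 : y ∈ m x y := (hrev y y x hxy).1
    exact (hlm4 x y).unique ⟨h1, (hlm1 x).2, hyx⟩ ⟨h2, hxy, (hlm1 y).2⟩
  · intro x y z hxy hyz
    rw [← hlm2 z]
    simp only [setMul, Set.mem_iUnion]
    exact ⟨y, hyz, y, hyz, hxy⟩
end

section
/- Let (L,∧,∨,0,1) be a bounded lattice and for x,y ∈ L set x⊞y := N∨(x,y). Then (L,⊞,0) is a commutative, total and reproductive mosaic in which every element is its own unique inverse; explicitly: 0⊞x = {x} = x⊞0 for all x; x⊞y = y⊞x for all x,y; x∨y ∈ x⊞y (so x⊞y ≠ ∅) for all x,y; z ∈ x⊞y implies x ∈ z⊞y and y ∈ x⊞z (reversibility with respect to the identity); 0 ∈ x⊞y holds if and only if y = x; and for all x,t ∈ L there exists y ∈ L with t ∈ x⊞y (reproductivity). -/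
/-- The additive Nakano multioperation of a lattice:
`N∨(x,y) := {z | x ∨ y = x ∨ z and x ∨ y = z ∨ y}`. -/
def Nsup {L : Type*} [Lattice L] (x y : L) : Set L :=
  {z | x ⊔ y = x ⊔ z ∧ x ⊔ y = z ⊔ y}

/-- The additive Nakano mosaic `(L, ⊞, 0)` of a bounded lattice is a
commutative, total, reproductive mosaic in which every element is its own
unique inverse. -/
theorem nakano_mosaic {L : Type*} [Lattice L] [BoundedOrder L] :
    (∀ x : L, Nsup (⊥ : L) x = {x} ∧ Nsup x (⊥ : L) = {x}) ∧
    (∀ x y : L, Nsup x y = Nsup y x) ∧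
    (∀ x y : L, x ⊔ y ∈ Nsup x y) ∧
    (∀ x y z : L, z ∈ Nsup x y → x ∈ Nsup z y ∧ y ∈ Nsup x z) ∧
    (∀ x y : L, (⊥ : L) ∈ Nsup x y ↔ y = x) ∧
    (∀ x t : L, ∃ y : L, t ∈ Nsup x y) := by
  refine ⟨fun x => ⟨?_, ?_⟩, fun x y => ?_, fun x y => ?_, fun x y z h => ?_, fun x y => ?_,
    fun x t => ⟨x ⊔ t, ?_⟩⟩
  · ext z
    simp only [Nsup, Set.mem_setOf_eq, bot_sup_eq, Set.mem_singleton_iff]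
    constructor
    · rintro ⟨h, -⟩
      exact h.symm
    · rintro rfl
      simp
  · ext z
    simp only [Nsup, Set.mem_setOf_eq, sup_bot_eq, Set.mem_singleton_iff]
    constructor
    · rintro ⟨-, h⟩
      exact h.symm
    · rintro rfl
      simp
  · ext z
    simp only [Nsup, Set.mem_setOf_eq]
    rw [sup_comm y x, sup_comm y z, sup_comm z x]
    exact and_comm
  · simp [Nsup]
  · obtain ⟨h1, h2⟩ := h
    refine ⟨⟨?_, h2.symm⟩, ⟨h1.symm, ?_⟩⟩
    · rw [← h2, h1, sup_comm]
    · rw [← h1, h2, sup_comm]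
  · simp only [Nsup, Set.mem_setOf_eq, sup_bot_eq, bot_sup_eq]
    constructor
    · rintro ⟨h1, h2⟩
      exact h2.symm.trans h1
    · rintro rfl
      simp
  · simp [Nsup, sup_left_comm]
end

section
/- Let (L,∧,∨,0,1) and (L',∧',∨',0',1') be bounded lattices and f : L → L' a function. Then f preserves binary joins (f(x∨y) = f(x)∨'f(y) for all x,y ∈ L) if and only if f is a morphism of the associated additive Nakano mosaics, i.e., for all x,y,z ∈ L, z ∈ N∨(x,y) implies f(z) ∈ N∨'(f(x),f(y)). -/
/-- A function between bounded lattices preserves binary joins iff it is a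
morphism of the associated additive Nakano mosaics. -/
theorem join_hom_iff_mosaic_morphism {L L' : Type*}
    [Lattice L] [BoundedOrder L] [Lattice L'] [BoundedOrder L'] (f : L → L') :
    (∀ x y : L, f (x ⊔ y) = f x ⊔ f y) ↔
      (∀ x y z : L, z ∈ Nsup x y → f z ∈ Nsup (f x) (f y)) := by
  constructor
  · rintro h x y z ⟨h1, h2⟩
    exact ⟨by rw [← h, ← h, h1], by rw [← h, ← h, h2]⟩
  · intro h x y
    have mono : ∀ a b : L, a ≤ b → f a ≤ f b := by
      intro a b hab
      have := (h b b a ⟨by simp [hab], by simp [hab]⟩).1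
      rw [sup_idem] at this
      rw [this]
      exact le_sup_right
    apply le_antisymm
    · have := (h x y (x ⊔ y) ⟨by simp, by simp⟩).1
      rw [this]
      exact le_sup_right
    · exact sup_le (mono _ _ le_sup_left) (mono _ _ le_sup_right)
end

section
/- Let (A,⊞,0) be an L-mosaic and let s : A × A → A be a function such that for all x,y ∈ A: s(x,y) ∈ x⊞y, x ∈ s(x,y)⊞s(x,y) and y ∈ s(x,y)⊞s(x,y) (i.e., s(x,y) is the unique element guaranteed by (Lms4), so s is the join of the induced order). Then for all a,b,c ∈ A: c ∈ a⊞b if and only if s(a,b) = s(a,c) and s(a,b) = s(b,c). In other words, the multioperation of A is recovered as the Nakano multioperation of the induced join-semilattice. -/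
/-- In an L-mosaic `(A, ⊞, 0)` with join function `s` (the function provided by
(Lms4)), the multioperation is recovered as the Nakano multioperation of the
induced join-semilattice: `c ∈ a ⊞ b ↔ s a b = s a c ∧ s a b = s b c`. -/
theorem lmosaic_is_nakano {A : Type*} (m : A → A → Set A) (z₀ : A)
    (hcomm : ∀ x y : A, m x y = m y x)
    (hneut : ∀ x : A, m z₀ x = {x})
    (hrev : ∀ x y z : A, z ∈ m x y → x ∈ m z y ∧ y ∈ m x z)
    (hlm1 : ∀ x : A, z₀ ∈ m x x ∧ x ∈ m x x)
    (hlm2 : ∀ x : A, setMul m (m x x) (m x x) = m x x)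
    (hlm3 : ∀ x y : A, setMul m {x} (m x y) ∩ setMul m (m x y) {y} ⊆ m x y)
    (hlm4 : ∀ x y : A, ∃! z : A, z ∈ m x y ∧ x ∈ m z z ∧ y ∈ m z z)
    (s : A → A → A)
    (hs : ∀ x y : A, s x y ∈ m x y ∧ x ∈ m (s x y) (s x y) ∧ y ∈ m (s x y) (s x y)) :
    ∀ a b c : A, c ∈ m a b ↔ s a b = s a c ∧ s a b = s b c := by
  have hle : ∀ x y z w : A, x ∈ m z z → y ∈ m z z → w ∈ m x y → w ∈ m z z := by
    intro x y z w hx hy hw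
    rw [← hlm2 z]
    simp only [setMul, Set.mem_iUnion]
    exact ⟨x, hx, y, hy, hw⟩
  have hanti : ∀ x y : A, x ∈ m y y → y ∈ m x x → x = y := by
    intro x y hx hy
    have h1 : x ∈ m x y := by
      rw [hcomm]
      exact (hrev x x y hy).1
    have h2 : y ∈ m x y := (hrev y y x hx).2 |> fun h => by rw [hcomm]; exact h
    exact (hlm4 x y).unique ⟨h1, (hlm1 x).2, hy⟩ ⟨h2, hx, (hlm1 y).2⟩
  have hjoin : ∀ x y z : A, x ∈ m z z → y ∈ m z z → s x y ∈ m z z :=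
    fun x y z hx hy => hle x y z _ hx hy (hs x y).1
  have key : ∀ a b c : A, c ∈ m a b → s a b = s a c := by
    intro a b c hc
    have h1 := hle a b _ c (hs a b).2.1 (hs a b).2.2 hc
    have h2 := hle a c _ b (hs a c).2.1 (hs a c).2.2 (hrev a b c hc).2
    exact hanti _ _ (hjoin _ _ _ (hs a c).2.1 h2) (hjoin _ _ _ (hs a b).2.1 h1)
  have scomm : ∀ a b : A, s a b = s b a := fun a b =>
    hanti _ _ (hjoin _ _ _ (hs b a).2.2 (hs b a).2.1) (hjoin _ _ _ (hs a b).2.2 (hs a b).2.1)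
  intro a b c
  constructor
  · intro hc
    refine ⟨key a b c hc, ?_⟩
    rw [scomm a b]
    exact key b a c (by rw [hcomm]; exact hc)
  · rintro ⟨h1, h2⟩
    apply hlm3 a b
    simp only [setMul, Set.mem_inter_iff, Set.mem_iUnion]
    refine ⟨⟨a, rfl, s a b, (hs a b).1, ?_⟩, ⟨s a b, (hs a b).1, b, rfl, ?_⟩⟩
    · rw [h1]
      exact (hrev a c _ (hs a c).1).2
    · rw [h2, hcomm]
      exact (hrev b c _ (hs b c).1).2
end

section
/- Let (L,∧,∨,0,1) be a bounded lattice and π : L → L an orthocomplementation, i.e. π is an involution (π(π(x)) = x), antitone (x ≤ y implies π(y) ≤ π(x)), and x∨π(x) = 1 and x∧π(x) = 0 for all x. Then L is π-orthomodular (for all x,y, x ≤ y implies x∨(π(x)∧y) = y) if and only if for all x,y ∈ L: x ∈ N∨(y,y) and 1 ∈ N∨(x,π(y)) imply x = y. -/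
/-- A `π`-ortholattice is `π`-orthomodular iff in the associated dualizable
L-mosaic, `x ∈ y ⊞ y` and `1 ∈ x ⊞ π(y)` imply `x = y`. -/
theorem orthomodular_iff_mosaic {L : Type*} [Lattice L] [BoundedOrder L] (π : L → L)
    (hinv : ∀ x : L, π (π x) = x)
    (hanti : ∀ x y : L, x ≤ y → π y ≤ π x)
    (hsup : ∀ x : L, x ⊔ π x = ⊤)
    (hinf : ∀ x : L, x ⊓ π x = ⊥) :
    (∀ x y : L, x ≤ y → x ⊔ (π x ⊓ y) = y) ↔
      (∀ x y : L, x ∈ Nsup y y → (⊤ : L) ∈ Nsup x (π y) → x = y) := by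
  constructor
  · intro h x y hx ht
    have hxy : x ≤ y := by
      have h1 := hx.1
      rw [sup_idem] at h1
      rw [h1]; exact le_sup_right
    have htop : x ⊔ π y = ⊤ := by
      have h1 := ht.1
      rwa [sup_top_eq] at h1
    have hz : π (π x ⊓ y) = ⊤ := by
      apply top_unique
      rw [← htop]
      apply sup_le
      · have h2 := hanti _ _ (inf_le_left : π x ⊓ y ≤ π x)
        rwa [hinv] at h2
      · exact hanti _ _ inf_le_right
    have hbot : π x ⊓ y = ⊥ := by
      have h3 := hinf (π x ⊓ y)
      rwa [hz, inf_top_eq] at h3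
    have h4 := h x y hxy
    rwa [hbot, sup_bot_eq] at h4
  · intro h x y hxy
    have hay : x ⊔ (π x ⊓ y) ≤ y := sup_le hxy inf_le_right
    have htop : (x ⊔ (π x ⊓ y)) ⊔ π y = ⊤ := by
      have h1 : π ((x ⊔ (π x ⊓ y)) ⊔ π y) ≤ π x ⊓ y := by
        apply le_inf
        · exact hanti _ _ (le_sup_left.trans le_sup_left)
        · have h2 := hanti _ _ (le_sup_right : π y ≤ (x ⊔ (π x ⊓ y)) ⊔ π y)
          rwa [hinv] at h2
      have h3 := hsup ((x ⊔ (π x ⊓ y)) ⊔ π y)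
      rwa [sup_eq_left.mpr (h1.trans (le_sup_right.trans le_sup_left))] at h3
    apply h
    · refine ⟨?_, ?_⟩
      · rw [sup_idem, sup_eq_left.mpr hay]
      · rw [sup_idem, sup_eq_right.mpr hay]
    · refine ⟨?_, ?_⟩
      · rw [htop, sup_top_eq]
      · rw [htop, top_sup_eq]
end
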